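/- arXiv:2304.11355 — 2 statements merged into one kernel-verified Lean document; each statement's English description precedes it below -/
import Mathlib

section
/- Let R = k[[t]] be a formal power series ring over a field k of characteristic 0, K = k((t)), and consider a three-term complex of finitely generated R-modules P →^{d_0} F →^{d_1} G with F and G finite free of ranks d + r and r respectively, P of rank d, d_1 ∘ d_0 = 0, and such that after tensoring with K the complex is exact with d_1 ⊗ K surjective and d_0 ⊗ K injective. Then: dim_k coker(d_1) = ord_t Fitt_0(coker(d_1)) and dim_k (ker(d_1)/im(d_0)) = ord_t Fitt_r(coker(d_0)), and both quantities are finite. -/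
open PowerSeries TensorProduct

set_option synthInstance.maxHeartbeats 1000000
set_option maxHeartbeats 1000000

/-- The ideal generated by all `s × s` minors of a matrix. -/
noncomputable def minorsIdeal {R : Type*} [CommRing R] {m n : ℕ}
    (A : Matrix (Fin m) (Fin n) R) (s : ℕ) : Ideal R :=
  Ideal.span { x | ∃ (r : Fin s → Fin m) (c : Fin s → Fin n), x = (A.submatrix r c).det }

/-- The `j`-th Fitting ideal of the cokernel of the linear map `R^n → R^m`
presented by the matrix `A : Matrix (Fin m) (Fin n) R`: it is generated by the
`(m - j) × (m - j)` minors of `A`. -/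
noncomputable def matrixFittingIdeal {R : Type*} [CommRing R] {m n : ℕ}
    (A : Matrix (Fin m) (Fin n) R) (j : ℕ) : Ideal R :=
  minorsIdeal A (m - j)

section Minors

variable {R : Type*} [CommRing R] {m n l s : ℕ}

theorem minorsIdeal_transpose (A : Matrix (Fin m) (Fin n) R) :
    minorsIdeal A.transpose s = minorsIdeal A s := by
  unfold minorsIdeal
  congr 1
  ext x
  constructor
  · rintro ⟨r, c, rfl⟩
    exact ⟨c, r, by rw [← Matrix.det_transpose, Matrix.transpose_submatrix,
      Matrix.transpose_transpose]⟩
  · rintro ⟨r, c, rfl⟩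
    exact ⟨c, r, by rw [← Matrix.det_transpose, Matrix.transpose_submatrix]⟩

theorem minorsIdeal_mul_le_right (A : Matrix (Fin m) (Fin n) R) (B : Matrix (Fin n) (Fin l) R) :
    minorsIdeal (A * B) s ≤ minorsIdeal B s := by
  unfold minorsIdeal
  rw [Ideal.span_le]
  rintro x ⟨r, c, rfl⟩
  have h : ((A * B).submatrix r c).det =
      ∑ p : Fin s → Fin n, (∏ i, A (r i) (p i)) • (B.submatrix p c).det := by
    have h1 : ((A * B).submatrix r c) = fun i => ∑ j, A (r i) j • (fun q => B j (c q)) := by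
      ext i q
      simp [Matrix.mul_apply]
    rw [h1]
    refine (Matrix.detRowAlternating.toMultilinearMap.map_sum
      (fun i j => A (r i) j • (fun q => B j (c q)))).trans ?_
    refine Finset.sum_congr rfl fun p _ => ?_
    exact Matrix.detRowAlternating.toMultilinearMap.map_smul_univ
      (fun i => A (r i) (p i)) (fun i q => B (p i) (c q))
  rw [h]
  exact Ideal.sum_mem _ fun p _ => Ideal.mul_mem_left _ _ (Ideal.subset_span ⟨p, c, rfl⟩)

theorem minorsIdeal_mul_le_left (A : Matrix (Fin m) (Fin n) R) (B : Matrix (Fin n) (Fin l) R) :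
    minorsIdeal (A * B) s ≤ minorsIdeal A s := by
  rw [← minorsIdeal_transpose (A * B), ← minorsIdeal_transpose A, Matrix.transpose_mul]
  exact minorsIdeal_mul_le_right _ _

theorem minorsIdeal_diagonal (a : Fin s → R) :
    minorsIdeal (Matrix.diagonal a) s = Ideal.span {∏ i, a i} := by
  apply le_antisymm
  · unfold minorsIdeal
    rw [Ideal.span_le]
    rintro x ⟨r, c, rfl⟩
    have h : (Matrix.diagonal a).submatrix r c =
        (1 : Matrix (Fin s) (Fin s) R).submatrix r id * Matrix.diagonal a *
          (1 : Matrix (Fin s) (Fin s) R).submatrix id c := by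
      ext i j
      simp only [Matrix.submatrix_apply, Matrix.mul_apply, Matrix.diagonal_apply,
        Matrix.one_apply, id]
      simp +contextual
    rw [h, Matrix.det_mul, Matrix.det_mul, Matrix.det_diagonal]
    exact Ideal.mul_mem_right _ _ (Ideal.mul_mem_left _ _ (Ideal.subset_span rfl))
  · rw [Ideal.span_singleton_le_iff_mem]
    exact Ideal.subset_span ⟨id, id, by simp⟩

end Minors

theorem exists_minorsIdeal_eq_and_quotient_equiv_pi {R : Type*} [CommRing R] [IsDomain R]
    [IsPrincipalIdealRing R] {m n s : ℕ} (φ : (Fin m → R) →ₗ[R] (Fin n → R))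
    (L : Submodule R (Fin n → R)) (hle : LinearMap.range φ ≤ L)
    (hsat : ∀ (c : R) (x : Fin n → R), c ≠ 0 → c • x ∈ L → x ∈ L)
    (htors : ∀ x ∈ L, ∃ c : R, c ≠ 0 ∧ c • x ∈ LinearMap.range φ)
    (hrank : Module.finrank R (LinearMap.range φ) = s) :
    ∃ a : Fin s → R, (∀ i, a i ≠ 0) ∧
      minorsIdeal (LinearMap.toMatrix' φ) s = Ideal.span {∏ i, a i} ∧
      Nonempty ((L ⧸ (LinearMap.range φ).comap L.subtype) ≃ₗ[R]
        ∀ i, R ⧸ Ideal.span {a i}) := by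
  obtain ⟨s', bM, bN, f, a, hsnf⟩ :=
    (LinearMap.range φ).smithNormalForm (Pi.basisFun R (Fin n))
  have hs : s' = s := by rw [← hrank, Module.finrank_eq_card_basis bN, Fintype.card_fin]
  subst hs
  have ha : ∀ i, a i ≠ 0 := by
    intro i h0
    apply bN.ne_zero i
    ext1
    simp [hsnf, h0]
  have hmem : ∀ i, bM (f i) ∈ L := fun i =>
    hsat (a i) _ (ha i) (hsnf i ▸ hle (bN i).2)
  have hzero : ∀ x ∈ LinearMap.range φ, ∀ j ∉ Set.range f, bM.repr x j = 0 := by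
    intro x hx j hj
    exact Module.Basis.SmithNormalForm.repr_eq_zero_of_notMem_range
      ⟨bM, bN, f, a, hsnf⟩ ⟨x, hx⟩ hj
  have hzeroL : ∀ x ∈ L, ∀ j ∉ Set.range f, bM.repr x j = 0 := by
    intro x hx j hj
    obtain ⟨c, hc, hcx⟩ := htors x hx
    have := hzero _ hcx j hj
    simpa [hc] using this
  have hcoord : ∀ (x : LinearMap.range φ) (i),
      bM.repr (x : Fin n → R) (f i) = bN.repr x i * a i := by
    intro x i
    have hx : (x : Fin n → R) = ∑ i, bN.repr x i • a i • bM (f i) := by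
      have := congrArg (Submodule.subtype _) (bN.sum_repr x)
      simpa only [map_sum, map_smul, Submodule.subtype_apply, hsnf] using this.symm
    rw [hx]
    simp [Finsupp.single_apply, f.injective.eq_iff]
  refine ⟨a, ha, ?_, ?_⟩
  · choose σ hσ using fun i => (bN i).2
    let V : Matrix (Fin n) (Fin s') R := Matrix.of fun j i => bM (f i) j
    let V' : Matrix (Fin s') (Fin n) R := Matrix.of fun i j => bM.repr (Pi.single j 1) (f i)
    let Q : Matrix (Fin s') (Fin m) R :=
      Matrix.of fun i l => bN.repr ⟨φ (Pi.single l 1), LinearMap.mem_range_self φ _⟩ i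
    let S : Matrix (Fin m) (Fin s') R := Matrix.of fun l i => σ i l
    have hV' : ∀ (x : Fin n → R) i, ∑ j, V' i j * x j = bM.repr x (f i) := by
      intro x i
      conv_rhs => rw [pi_eq_sum_univ' x]
      simp [V', mul_comm]
    have hA : LinearMap.toMatrix' φ = V * Matrix.diagonal a * Q := by
      ext j l
      have hx := congrFun (congrArg (Submodule.subtype _)
        (bN.sum_repr ⟨φ (Pi.single l 1), LinearMap.mem_range_self φ _⟩)) j
      simp only [map_sum, map_smul, Submodule.subtype_apply, hsnf, Finset.sum_apply,
        Pi.smul_apply, smul_eq_mul] at hx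
      rw [LinearMap.toMatrix'_apply, ← hx, Matrix.mul_apply]
      refine Finset.sum_congr rfl fun i _ => ?_
      simp only [Matrix.mul_diagonal, V, Q, Matrix.of_apply]
      ring
    have hD : Matrix.diagonal a = V' * LinearMap.toMatrix' φ * S := by
      ext i i'
      have h1 : LinearMap.toMatrix' φ * S = Matrix.of fun j i => a i * bM (f i) j := by
        ext j i
        have := congrFun (LinearMap.toMatrix'_mulVec φ (σ i)) j
        rw [hσ, hsnf] at this
        simpa [Matrix.mulVec, dotProduct, Matrix.mul_apply, S] using this
      rw [Matrix.mul_assoc, h1]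
      have := hV' (a i' • bM (f i')) i
      simp only [Matrix.mul_apply, Matrix.of_apply]
      simp only [Pi.smul_apply, smul_eq_mul] at this
      rw [this]
      rcases eq_or_ne i i' with rfl | h
      · simp
      · simp [h]
    rw [← minorsIdeal_diagonal]
    apply le_antisymm
    · rw [hA]
      exact (minorsIdeal_mul_le_left _ _).trans (minorsIdeal_mul_le_right _ _)
    · conv_lhs => rw [hD]
      exact (minorsIdeal_mul_le_left _ _).trans (minorsIdeal_mul_le_right _ _)
  · let g : L →ₗ[R] (∀ i, R ⧸ Ideal.span {a i}) := LinearMap.pi fun i =>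
      (Ideal.span {a i}).mkQ ∘ₗ bM.coord (f i) ∘ₗ L.subtype
    have hg : Function.Surjective g := by
      intro y
      choose c hc using fun i => Submodule.mkQ_surjective _ (y i)
      refine ⟨⟨∑ i, c i • bM (f i), L.sum_mem fun i _ => L.smul_mem _ (hmem i)⟩, ?_⟩
      ext i
      rw [← hc i]
      simp [g, Finsupp.single_apply, f.injective.eq_iff]
    have hker : (LinearMap.range φ).comap L.subtype = LinearMap.ker g := by
      ext x
      rw [LinearMap.mem_ker, funext_iff, Submodule.mem_comap]
      have hgi : ∀ i, g x i = (0 : ∀ i, R ⧸ Ideal.span {a i}) i ↔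
          a i ∣ bM.repr (x : Fin n → R) (f i) := by
        intro i
        rw [← Ideal.mem_span_singleton]
        exact Submodule.Quotient.mk_eq_zero _
      simp only [hgi]
      constructor
      · intro hx i
        exact ⟨_, (hcoord ⟨_, hx⟩ i).trans (mul_comm _ _)⟩
      · intro h
        choose c hc using h
        have : (x : Fin n → R) = ∑ i, c i • (bN i : Fin n → R) := by
          apply bM.ext_elem
          intro j
          by_cases hj : j ∈ Set.range f
          · obtain ⟨i, rfl⟩ := hj
            rw [hc]
            simp [hsnf, Finsupp.single_apply, f.injective.eq_iff, mul_comm]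
          · rw [hzeroL x x.2 j hj]
            have : ∀ i, f i ≠ j := fun i hi => hj ⟨i, hi⟩
            simp [hsnf, this]
        change (x : Fin n → R) ∈ _
        rw [this]
        exact Submodule.sum_mem _ fun i _ => Submodule.smul_mem _ _ (bN i).2
    exact ⟨(Submodule.quotEquivOfEq _ _ hker).trans (g.quotKerEquivOfSurjective hg)⟩

section Rank

variable {R K M N : Type*} [CommRing R] [Field K] [Algebra R K] [IsFractionRing R K]
  [AddCommGroup M] [Module R M] [AddCommGroup N] [Module R N] (f : M →ₗ[R] N)

theorem finrank_tensorProduct_fractionRing :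
    Module.finrank K (K ⊗[R] M) = Module.finrank R M := by
  rw [IsLocalization.finrank_eq K (nonZeroDivisors R) le_rfl]
  exact IsLocalizedModule.finrank_eq (nonZeroDivisors R) (TensorProduct.mk R K M 1) le_rfl

theorem finrank_range_eq_of_baseChange_injective
    (h : Function.Injective (f.baseChange K)) :
    Module.finrank R (LinearMap.range f) = Module.finrank K (K ⊗[R] M) := by
  rw [← finrank_tensorProduct_fractionRing (K := K)]
  refine (LinearEquiv.finrank_eq (LinearEquiv.ofBijective (f.rangeRestrict.baseChange K)
    ⟨?_, LinearMap.lTensor_surjective K f.surjective_rangeRestrict⟩)).symm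
  have hf : f.baseChange K =
      (LinearMap.range f).subtype.baseChange K ∘ₗ f.rangeRestrict.baseChange K := by
    rw [← LinearMap.baseChange_comp]; rfl
  rw [hf] at h
  exact Function.Injective.of_comp h

theorem finrank_range_eq_of_baseChange_surjective
    (h : Function.Surjective (f.baseChange K)) :
    Module.finrank R (LinearMap.range f) = Module.finrank R N := by
  rw [← finrank_tensorProduct_fractionRing (K := K) (M := LinearMap.range f),
    ← finrank_tensorProduct_fractionRing (K := K) (M := N)]
  have : Module.Flat R K := IsLocalization.flat K (nonZeroDivisors R)
  refine LinearEquiv.finrank_eq (LinearEquiv.ofBijective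
    ((LinearMap.range f).subtype.baseChange K)
    ⟨Module.Flat.lTensor_preserves_injective_linearMap _ (Submodule.subtype_injective _), ?_⟩)
  have hf : f.baseChange K =
      (LinearMap.range f).subtype.baseChange K ∘ₗ f.rangeRestrict.baseChange K := by
    rw [← LinearMap.baseChange_comp]; rfl
  rw [hf] at h
  exact Function.Surjective.of_comp h

theorem exists_smul_mem_of_finrank_eq {R M : Type*} [CommRing R] [IsDomain R] [AddCommGroup M]
    [Module R M] [Module.Finite R M] [IsNoetherianRing R] {N L : Submodule R M} (hle : N ≤ L)
    (h : Module.finrank R N = Module.finrank R L) :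
    ∀ x ∈ L, ∃ c : R, c ≠ 0 ∧ c • x ∈ N := by
  have h1 := (N.comap L.subtype).finrank_quotient_add_finrank
  rw [(Submodule.comapSubtypeEquivOfLe hle).finrank_eq, h, Nat.add_eq_right,
    Module.finrank_eq_zero_iff] at h1
  intro x hx
  obtain ⟨c, hc, h⟩ := h1 (Submodule.Quotient.mk ⟨x, hx⟩)
  rw [← Submodule.Quotient.mk_smul, Submodule.Quotient.mk_eq_zero] at h
  exact ⟨c, hc, h⟩

end Rank

section PowerSeries

variable {k : Type*} [Field k]

theorem finite_and_finrank_quotient_span_X_pow (e : ℕ) :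
    Module.Finite k (k⟦X⟧ ⧸ Ideal.span {(X : k⟦X⟧) ^ e}) ∧
      Module.finrank k (k⟦X⟧ ⧸ Ideal.span {(X : k⟦X⟧) ^ e}) = e := by
  let g : k⟦X⟧ →ₗ[k] (Fin e → k) := LinearMap.pi fun i => coeff (i : ℕ)
  have hg : Function.Surjective g := fun y =>
    ⟨mk fun n => if h : n < e then y ⟨n, h⟩ else 0, by ext i; simp [g]⟩
  have hker : (Ideal.span {(X : k⟦X⟧) ^ e}).restrictScalars k = LinearMap.ker g := by
    ext x
    rw [Submodule.restrictScalars_mem, Ideal.mem_span_singleton, X_pow_dvd_iff,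
      LinearMap.mem_ker, funext_iff]
    exact ⟨fun h i => h i i.2, fun h n hn => h ⟨n, hn⟩⟩
  let E : (k⟦X⟧ ⧸ Ideal.span {(X : k⟦X⟧) ^ e}) ≃ₗ[k] (Fin e → k) :=
    (Submodule.Quotient.restrictScalarsEquiv k (Ideal.span {(X : k⟦X⟧) ^ e})).symm.trans
      ((Submodule.quotEquivOfEq _ _ hker).trans (g.quotKerEquivOfSurjective hg))
  exact ⟨Module.Finite.equiv E.symm, by rw [E.finrank_eq, Module.finrank_fin_fun]⟩

theorem finite_and_span_prod_eq_of_linearEquiv {s : ℕ} {a : Fin s → k⟦X⟧} (ha : ∀ i, a i ≠ 0)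
    {W : Type*} [AddCommGroup W] [Module k⟦X⟧ W]
    (E : W ≃ₗ[k⟦X⟧] ∀ i, k⟦X⟧ ⧸ Ideal.span {a i}) :
    Module.Finite k (RestrictScalars k k⟦X⟧ W) ∧
      Ideal.span {∏ i, a i} =
        Ideal.span {(X : k⟦X⟧) ^ Module.finrank k (RestrictScalars k k⟦X⟧ W)} := by
  have hspan : ∀ i, Ideal.span {a i} = Ideal.span {(X : k⟦X⟧) ^ (a i).order.toNat} := by
    intro i
    rw [Ideal.span_singleton_eq_span_singleton]
    refine Associated.symm ⟨Unit_of_divided_by_X_pow_order (a i), ?_⟩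
    rw [Unit_of_divided_by_X_pow_order_nonzero (ha i)]
    exact X_pow_order_mul_divXPowOrder
  have hdim : ∀ i, Module.Finite k (k⟦X⟧ ⧸ Ideal.span {a i}) ∧
      Module.finrank k (k⟦X⟧ ⧸ Ideal.span {a i}) = (a i).order.toNat := by
    intro i
    rw [hspan i]
    exact finite_and_finrank_quotient_span_X_pow _
  have := fun i => (hdim i).1
  let : Module k⟦X⟧ (RestrictScalars k k⟦X⟧ W) := RestrictScalars.moduleOrig k k⟦X⟧ W
  let E' : RestrictScalars k k⟦X⟧ W ≃ₗ[k] ∀ i, k⟦X⟧ ⧸ Ideal.span {a i} :=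
    LinearEquiv.restrictScalars k (S := k⟦X⟧) (M := RestrictScalars k k⟦X⟧ W) E
  refine ⟨Module.Finite.equiv E'.symm, ?_⟩
  rw [E'.finrank_eq, Module.finrank_pi_fintype, ← Finset.prod_pow_eq_pow_sum,
    ← Ideal.prod_span_singleton, ← Ideal.prod_span_singleton]
  exact Finset.prod_congr rfl fun i _ => by rw [(hdim i).2, hspan i]

end PowerSeries

/-- Let `R = k[[t]]` with `char k = 0`, `K = k((t))`, and let
`P →d₀ R^{d+r} →d₁ R^r` be a complex with `P` finitely generated of rank `d`, which
becomes exact after `⊗K`, with `d₁ ⊗ K` surjective and `d₀ ⊗ K` injective.  Then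
`coker d₁` and `ker d₁ / im d₀` are finite dimensional over `k`, with
`dim_k coker d₁ = ord_t Fitt_0(coker d₁)` and
`dim_k (ker d₁ / im d₀) = ord_t Fitt_r(coker d₀)` (the latter computed from any
presentation `R^m ↠ P`). -/
theorem statement16 (k : Type) [Field k] [CharZero k] (d r : ℕ)
    (P : Type) [AddCommGroup P] [Module (PowerSeries k) P] [Module.Finite (PowerSeries k) P]
    (d₀ : P →ₗ[PowerSeries k] (Fin (d + r) → PowerSeries k))
    (d₁ : (Fin (d + r) → PowerSeries k) →ₗ[PowerSeries k] (Fin r → PowerSeries k))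
    (hcomp : d₁ ∘ₗ d₀ = 0)
    (hrankP : Module.finrank (FractionRing (PowerSeries k))
      (FractionRing (PowerSeries k) ⊗[PowerSeries k] P) = d)
    (hexact : LinearMap.range (d₀.baseChange (FractionRing (PowerSeries k))) =
      LinearMap.ker (d₁.baseChange (FractionRing (PowerSeries k))))
    (hsurj : Function.Surjective (d₁.baseChange (FractionRing (PowerSeries k))))
    (hinj : Function.Injective (d₀.baseChange (FractionRing (PowerSeries k)))) :
    Module.Finite k (RestrictScalars k (PowerSeries k)
      ((Fin r → PowerSeries k) ⧸ LinearMap.range d₁)) ∧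
    Module.Finite k (RestrictScalars k (PowerSeries k)
      ((LinearMap.ker d₁) ⧸ (LinearMap.range d₀).comap (LinearMap.ker d₁).subtype)) ∧
    matrixFittingIdeal (LinearMap.toMatrix' d₁) 0 =
      Ideal.span {(PowerSeries.X : PowerSeries k) ^
        (Module.finrank k (RestrictScalars k (PowerSeries k)
          ((Fin r → PowerSeries k) ⧸ LinearMap.range d₁)))} ∧
    ∀ (m : ℕ) (p : (Fin m → PowerSeries k) →ₗ[PowerSeries k] P), Function.Surjective p →
      matrixFittingIdeal (LinearMap.toMatrix' (d₀ ∘ₗ p)) r =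
        Ideal.span {(PowerSeries.X : PowerSeries k) ^
          (Module.finrank k (RestrictScalars k (PowerSeries k)
            ((LinearMap.ker d₁) ⧸ (LinearMap.range d₀).comap (LinearMap.ker d₁).subtype)))} := by
  have hrank₀ : Module.finrank k⟦X⟧ (LinearMap.range d₀) = d := by
    rw [finrank_range_eq_of_baseChange_injective d₀ hinj, hrankP]
  have hrank₁ : Module.finrank k⟦X⟧ (LinearMap.range d₁) = r := by
    rw [finrank_range_eq_of_baseChange_surjective d₁ hsurj, Module.finrank_fin_fun]
  have hrankL : Module.finrank k⟦X⟧ (LinearMap.ker d₁) = d := by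
    have h := (LinearMap.ker d₁).finrank_quotient_add_finrank
    rw [d₁.quotKerEquivRange.finrank_eq, hrank₁, Module.finrank_fin_fun] at h
    omega
  have hle : LinearMap.range d₀ ≤ LinearMap.ker d₁ := LinearMap.range_le_ker_iff.mpr hcomp
  have hsat : ∀ (c : k⟦X⟧) (x : Fin (d + r) → k⟦X⟧), c ≠ 0 →
      c • x ∈ LinearMap.ker d₁ → x ∈ LinearMap.ker d₁ := by
    intro c x hc hx
    rw [LinearMap.mem_ker, map_smul] at hx
    exact (smul_eq_zero.mp hx).resolve_left hc
  have hcoker : Module.Finite k (RestrictScalars k (PowerSeries k)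
        ((Fin r → PowerSeries k) ⧸ LinearMap.range d₁)) ∧
      matrixFittingIdeal (LinearMap.toMatrix' d₁) 0 =
        Ideal.span {(PowerSeries.X : PowerSeries k) ^
          (Module.finrank k (RestrictScalars k (PowerSeries k)
            ((Fin r → PowerSeries k) ⧸ LinearMap.range d₁)))} := by
    obtain ⟨a, ha, hminors, ⟨E⟩⟩ := exists_minorsIdeal_eq_and_quotient_equiv_pi d₁ ⊤ le_top
      (fun _ _ _ _ => Submodule.mem_top)
      (exists_smul_mem_of_finrank_eq le_top (by rw [hrank₁, finrank_top, Module.finrank_fin_fun]))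
      hrank₁
    have F : ((Fin r → PowerSeries k) ⧸ LinearMap.range d₁) ≃ₗ[k⟦X⟧]
        ((⊤ : Submodule k⟦X⟧ (Fin r → k⟦X⟧)) ⧸
          (LinearMap.range d₁).comap (⊤ : Submodule k⟦X⟧ (Fin r → k⟦X⟧)).subtype) :=
      (Submodule.Quotient.equiv _ _ Submodule.topEquiv (by
        ext x
        simp)).symm
    obtain ⟨hfin, hspan⟩ := finite_and_span_prod_eq_of_linearEquiv ha (F.trans E)
    exact ⟨hfin, by rw [matrixFittingIdeal, Nat.sub_zero, hminors, hspan]⟩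
  have hmid : ∀ (m : ℕ) (p : (Fin m → PowerSeries k) →ₗ[PowerSeries k] P),
      Function.Surjective p →
      Module.Finite k (RestrictScalars k (PowerSeries k)
        ((LinearMap.ker d₁) ⧸ (LinearMap.range d₀).comap (LinearMap.ker d₁).subtype)) ∧
      matrixFittingIdeal (LinearMap.toMatrix' (d₀ ∘ₗ p)) r =
        Ideal.span {(PowerSeries.X : PowerSeries k) ^
          (Module.finrank k (RestrictScalars k (PowerSeries k)
            ((LinearMap.ker d₁) ⧸ (LinearMap.range d₀).comap (LinearMap.ker d₁).subtype)))} := by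
    intro m p hp
    have hrange : LinearMap.range (d₀ ∘ₗ p) = LinearMap.range d₀ :=
      LinearMap.range_comp_of_range_eq_top _ (LinearMap.range_eq_top.mpr hp)
    obtain ⟨a, ha, hminors, ⟨E⟩⟩ := exists_minorsIdeal_eq_and_quotient_equiv_pi (d₀ ∘ₗ p)
      (LinearMap.ker d₁) (hrange ▸ hle) hsat
      (hrange ▸ exists_smul_mem_of_finrank_eq hle (hrank₀.trans hrankL.symm)) (hrange ▸ hrank₀)
    rw [hrange] at E
    obtain ⟨hfin, hspan⟩ := finite_and_span_prod_eq_of_linearEquiv ha E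
    exact ⟨hfin, by rw [matrixFittingIdeal, Nat.add_sub_cancel, hminors, hspan]⟩
  obtain ⟨m, p, hp⟩ := Module.Finite.exists_fin' k⟦X⟧ P
  exact ⟨hcoker.1, (hmid m p hp).1, hcoker.2, fun m p hp => (hmid m p hp).2⟩
end

section
/- Let X be a smooth irreducible variety over an algebraically closed field k of characteristic 0, and let D_1, D_2 be two Cartier divisors on X. Let Z ⊊ X be a proper closed subset containing the supports of D_1 and D_2. If for every arc φ: Spec K[[t]] → X (K ⊇ k a field extension) whose generic point lands in X ∖ Z one has ord_{D_1}(φ) = ord_{D_2}(φ), then D_1 = D_2. -/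
open PowerSeries

set_option synthInstance.maxHeartbeats 1000000
set_option maxHeartbeats 1000000

/-- The order of vanishing along an arc `φ : Spec K[[t]] → Spec A` of the closed subscheme
cut out by an ideal `I ⊆ A`: the minimum of the `t`-adic orders of the images of the
elements of `I` (equivalently, the order of the ideal generated by `φ(I)` in `K[[t]]`). -/
noncomputable def arcOrd {A K : Type} [CommRing A] [Field K]
    (φ : A →+* PowerSeries K) (I : Ideal A) : ℕ∞ :=
  ⨅ a ∈ I, PowerSeries.order (φ a)

open TensorProduct in
theorem isField_tensorProduct_fractionRing_of_etale (R S : Type*) [CommRing R] [IsDomain R]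
    [CommRing S] [IsDomain S] [Algebra R S] [Algebra.Etale R S] :
    IsField (S ⊗[R] FractionRing R) := by
  have : Module.Flat R S := inferInstance
  have hinj : Function.Injective (algebraMap R S) := FaithfulSMul.algebraMap_injective R S
  have : IsDomain (S ⊗[R] FractionRing R) :=
    IsLocalization.isDomain_of_le_nonZeroDivisors (R := S) (S := _)
      (M := Algebra.algebraMapSubmonoid S (nonZeroDivisors R))
      (map_le_nonZeroDivisors_of_injective _ hinj le_rfl)
  let e := Algebra.TensorProduct.comm R S (FractionRing R)
  have : IsDomain (FractionRing R ⊗[R] S) := e.symm.toMulEquiv.isDomain _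
  have : Module.Finite (FractionRing R) (FractionRing R ⊗[R] S) :=
    Algebra.FormallyUnramified.finite_of_free _ _
  exact e.toMulEquiv.isField
    (isField_of_isIntegral_of_isField' (R := FractionRing R) (Field.toIsField _))

open TensorProduct in
theorem exists_mul_eq_algebraMap_of_etale (R : Type*) {S : Type*} [CommRing R] [IsDomain R]
    [CommRing S] [IsDomain S] [Algebra R S] [Algebra.Etale R S] {s : S} (hs : s ≠ 0) :
    ∃ (s' : S) (r : R), r ≠ 0 ∧ s * s' = algebraMap R S r := by
  have hinj : Function.Injective (algebraMap R S) := FaithfulSMul.algebraMap_injective R S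
  let M := Algebra.algebraMapSubmonoid S (nonZeroDivisors R)
  have hM : M ≤ nonZeroDivisors S := map_le_nonZeroDivisors_of_injective _ hinj le_rfl
  have hST : Function.Injective (algebraMap S (S ⊗[R] FractionRing R)) :=
    IsLocalization.injective _ hM
  obtain ⟨t, ht⟩ := (isField_tensorProduct_fractionRing_of_etale R S).mul_inv_cancel
    ((map_ne_zero_iff _ hST).mpr hs)
  obtain ⟨⟨s', ⟨_, r, hr, rfl⟩⟩, h⟩ := IsLocalization.surj M t
  refine ⟨s', r, nonZeroDivisors.ne_zero hr, hST ?_⟩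
  rw [map_mul, ← h, ← mul_assoc, ht, one_mul]

open TensorProduct in
theorem isIntegrallyClosed_of_etale (R S : Type*) [CommRing R] [IsDomain R]
    [IsIntegrallyClosed R] [CommRing S] [IsDomain S] [Algebra R S] [Algebra.Etale R S] :
    IsIntegrallyClosed S := by
  let := (isField_tensorProduct_fractionRing_of_etale R S).toField
  have hinj : Function.Injective (algebraMap R S) := FaithfulSMul.algebraMap_injective R S
  have : IsFractionRing S (S ⊗[R] FractionRing R) := by
    refine IsLocalization.of_le_of_exists_dvd
      (Algebra.algebraMapSubmonoid S (nonZeroDivisors R)) _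
      (map_le_nonZeroDivisors_of_injective _ hinj le_rfl) fun s hs ↦ ?_
    obtain ⟨s', r, hr, h⟩ := exists_mul_eq_algebraMap_of_etale R (nonZeroDivisors.ne_zero hs)
    exact ⟨_, ⟨r, mem_nonZeroDivisors_of_ne_zero hr, rfl⟩, s', h.symm⟩
  rw [isIntegrallyClosed_iff (S ⊗[R] FractionRing R)]
  intro x hx
  obtain ⟨y, hy⟩ := (TensorProduct.toIntegralClosure_bijective_of_smooth
    (R := R) (S := S) (B := FractionRing R)).2 ⟨x, hx⟩
  replace hy := congr_arg Subtype.val hy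
  dsimp only at hy
  subst hy
  clear hx
  induction y with
  | zero => exact ⟨0, by simp⟩
  | add y z hy hz =>
    obtain ⟨s, hs⟩ := hy
    obtain ⟨t, ht⟩ := hz
    exact ⟨s + t, by rw [map_add, map_add, hs, ht]; rfl⟩
  | tmul s b =>
    obtain ⟨r, hr⟩ := IsIntegrallyClosed.isIntegral_iff.mp b.2
    refine ⟨s * algebraMap R S r, ?_⟩
    change _ = s ⊗ₜ[R] (b : FractionRing R)
    rw [← hr, Algebra.algebraMap_eq_smul_one (A := FractionRing R), ← TensorProduct.smul_tmul,
      Algebra.TensorProduct.algebraMap_apply, Algebra.algebraMap_self_apply,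
      Algebra.smul_def, mul_comm]

/-- The generic line `a + t y` through a point `a` of affine space is an injective arc. -/
theorem MvPolynomial.injective_eval₂Hom_line {k K : Type*} [Field k] [Field K] {σ : Type*}
    (f : k →+* K) (a : σ → K) :
    Function.Injective (MvPolynomial.eval₂Hom
      ((PowerSeries.C (R := FractionRing (MvPolynomial σ K))).comp ((algebraMap _ _).comp f))
      fun i ↦ PowerSeries.C (algebraMap K _ (a i)) +
        PowerSeries.X * PowerSeries.C (algebraMap (MvPolynomial σ K) _ (MvPolynomial.X i))) := by
  let P := MvPolynomial σ K
  let F := FractionRing P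
  let θ : MvPolynomial σ k →+* Polynomial P := MvPolynomial.eval₂Hom
    (Polynomial.C.comp (MvPolynomial.C.comp f))
    fun i ↦ Polynomial.C (MvPolynomial.C (a i)) + Polynomial.X * Polynomial.C (MvPolynomial.X i)
  let ι : Polynomial P →+* PowerSeries F :=
    Polynomial.coeToPowerSeries.ringHom.comp (Polynomial.mapRingHom (algebraMap P F))
  have hι : Function.Injective ι := by
    refine (Polynomial.coe_injective F).comp
      (Polynomial.map_injective _ (IsFractionRing.injective P F))
  have hθ : Function.Injective θ := by
    let ev : Polynomial P →+* P :=
      (MvPolynomial.aeval (fun i ↦ MvPolynomial.X i - MvPolynomial.C (a i)) :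
        P →ₐ[K] P).toRingHom.comp (Polynomial.evalRingHom 1)
    have : ev.comp θ = MvPolynomial.map f := by
      ext i : 2 <;> simp [ev, θ, P, MvPolynomial.algebraMap_eq]
    refine Function.Injective.of_comp (f := ev) ?_
    rw [← RingHom.coe_comp, this]
    exact MvPolynomial.map_injective _ f.injective
  convert! hι.comp hθ using 1
  rw [← RingHom.coe_comp]
  congr 1
  ext i : 2 <;>
    simp [ι, θ, P, F, IsScalarTower.algebraMap_apply K (MvPolynomial σ K)
      (FractionRing (MvPolynomial σ K)), PowerSeries.X_mul]

/-- Arcs on a formally smooth algebra lift from arcs on the base with prescribed special point. -/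
theorem Algebra.FormallySmooth.exists_powerSeries_lift {R S K : Type*} [CommRing R] [CommRing S]
    [Algebra R S] [Algebra.FormallySmooth R S] [Field K] (ψ : R →+* PowerSeries K) (π : S →+* K)
    (h : PowerSeries.constantCoeff.comp ψ = π.comp (algebraMap R S)) :
    ∃ φ : S →+* PowerSeries K, φ.comp (algebraMap R S) = ψ ∧
      PowerSeries.constantCoeff.comp φ = π := by
  let := ψ.toAlgebra
  let I : Ideal (PowerSeries K) := Ideal.span {PowerSeries.X}
  have hI (x y : PowerSeries K) : Ideal.Quotient.mk I x = Ideal.Quotient.mk I y ↔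
      PowerSeries.constantCoeff x = PowerSeries.constantCoeff y := by
    rw [Ideal.Quotient.eq, Ideal.mem_span_singleton, PowerSeries.X_dvd_iff, map_sub, sub_eq_zero]
  let f : S →ₐ[R] PowerSeries K ⧸ I :=
    { toRingHom := (Ideal.Quotient.mk I).comp (PowerSeries.C.comp π)
      commutes' := fun r ↦ by
        change Ideal.Quotient.mk I _ = Ideal.Quotient.mk I (ψ r)
        rw [hI]
        simpa using (congr($h r)).symm }
  obtain ⟨φ, hφ⟩ := exists_mkₐ_comp_eq_of_isAdicComplete f
  refine ⟨φ.toRingHom, φ.comp_algebraMap, ?_⟩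
  ext s
  have : Ideal.Quotient.mk I (φ s) = Ideal.Quotient.mk I (PowerSeries.C (π s)) := congr($hφ s)
  simpa using (hI _ _).mp this

/-- An étale domain over affine space admits injective arcs centred at any given point. -/
theorem exists_injective_arc_of_etale {k S κ : Type} [Field k] [CommRing S] [IsDomain S]
    [Algebra k S] {n : ℕ} [Algebra (MvPolynomial (Fin n) k) S]
    [IsScalarTower k (MvPolynomial (Fin n) k) S] [Algebra.Etale (MvPolynomial (Fin n) k) S]
    [Field κ] (π : S →+* κ) :
    ∃ (K : Type) (_ : Field K) (_ : Algebra k K) (φ : S →ₐ[k] PowerSeries K),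
      Function.Injective φ ∧ ∀ s, PowerSeries.constantCoeff (φ s) = 0 ↔ π s = 0 := by
  let R := MvPolynomial (Fin n) k
  let K := FractionRing (MvPolynomial (Fin n) κ)
  let j : k →+* κ := π.comp (algebraMap k S)
  let a : Fin n → κ := fun i ↦ π (algebraMap R S (MvPolynomial.X i))
  let ψ := MvPolynomial.eval₂Hom
      ((PowerSeries.C (R := K)).comp ((algebraMap _ _).comp j))
      fun i ↦ PowerSeries.C (algebraMap κ _ (a i)) +
        PowerSeries.X * PowerSeries.C (algebraMap (MvPolynomial (Fin n) κ) _ (MvPolynomial.X i))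
  have hψ : Function.Injective ψ := MvPolynomial.injective_eval₂Hom_line j a
  obtain ⟨φ, hφψ, hφ⟩ := Algebra.FormallySmooth.exists_powerSeries_lift (R := R) (S := S) ψ
    ((algebraMap κ K).comp π) (by
      ext i
      · simp [ψ, j, R, IsScalarTower.algebraMap_apply k (MvPolynomial (Fin n) k) S]
      · simp [ψ, a, R])
  refine ⟨K, inferInstance, ((algebraMap κ K).comp j).toAlgebra, ?_⟩
  let := ((algebraMap κ K).comp j).toAlgebra
  refine ⟨{ toRingHom := φ, commutes' := fun r ↦ ?_ }, ?_, fun s ↦ ?_⟩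
  · change φ (algebraMap k S r) = _
    rw [PowerSeries.algebraMap_apply]
    change _ = PowerSeries.C (algebraMap κ K (j r))
    rw [IsScalarTower.algebraMap_apply k R S]
    simpa [ψ, R, MvPolynomial.algebraMap_eq] using congr($hφψ (algebraMap k R r))
  · refine (injective_iff_map_eq_zero φ).mpr fun s hs ↦ ?_
    by_contra hne
    obtain ⟨s', r, hr, h⟩ := exists_mul_eq_algebraMap_of_etale R hne
    refine hr ((map_eq_zero_iff ψ hψ).mp ?_)
    rw [← hφψ, RingHom.comp_apply, ← h, map_mul, hs, zero_mul]
  · change PowerSeries.constantCoeff.comp φ s = 0 ↔ _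
    rw [hφ]
    simp

/-- In a smooth domain over a field, divisibility can be tested along injective arcs. If `a ∤ c`,
an associated prime `p = (a : d)` with `d` a multiple of `c` is stable under multiplication by
`d / a`, as one sees along an injective arc centred at `p`; so `d / a` is integral, contradicting
normality near `p`. -/
theorem dvd_of_forall_injective_arc {k A : Type} [Field k] [CommRing A] [IsDomain A]
    [Algebra k A] [Algebra.Smooth k A] {a c : A} (ha : a ≠ 0)
    (H : ∀ (K : Type) [Field K] [Algebra k K] (φ : A →ₐ[k] PowerSeries K),
      Function.Injective φ → φ a ∣ φ c) : a ∣ c := by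
  have : IsNoetherianRing A := Algebra.FiniteType.isNoetherianRing k A
  by_contra hac
  let M := A ⧸ Ideal.span {a}
  let x : Submodule.span A {(Ideal.Quotient.mk (Ideal.span {a}) c : M)} :=
    ⟨_, Submodule.mem_span_singleton_self _⟩
  have hx : x ≠ 0 := by
    rwa [Ne, Subtype.ext_iff, Submodule.coe_zero, Ideal.Quotient.eq_zero_iff_dvd]
  obtain ⟨p, hp, -⟩ := exists_le_isAssociatedPrime_of_isNoetherianRing A x hx
  obtain ⟨hpp, ⟨y, hy⟩, hpy⟩ := isAssociatedPrime_iff.mp hp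
  obtain ⟨r, rfl⟩ := Submodule.mem_span_singleton.mp hy
  replace hpy (z : A) : z ∈ p ↔ a ∣ z * (r * c) := by
    rw [hpy, Submodule.mem_colon_singleton, Submodule.mem_bot, Subtype.ext_iff,
      Submodule.coe_zero, ← Ideal.Quotient.eq_zero_iff_dvd]
    rfl
  set d := r * c with hd
  obtain ⟨f, hf, n, _, _, _⟩ :=
    Algebra.IsSmoothAt.exists_isStandardEtale_mvPolynomial (R := k) (p := p)
  have hf0 : f ≠ 0 := fun h ↦ hf (h ▸ p.zero_mem)
  have hfM : Submonoid.powers f ≤ nonZeroDivisors A :=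
    powers_le_nonZeroDivisors_of_noZeroDivisors hf0
  let S := Localization.Away f
  have : IsDomain S := IsLocalization.isDomain_localization hfM
  have hAS : Function.Injective (algebraMap A S) := IsLocalization.injective S hfM
  have : IsIntegrallyClosed S := isIntegrallyClosed_of_etale (MvPolynomial (Fin n) k) S
  let π : S →+* p.ResidueField := IsLocalization.Away.lift f (g := algebraMap A p.ResidueField)
    (by simpa using hf)
  have hπ (z : A) : π (algebraMap A S z) = 0 ↔ z ∈ p := by simp [π]
  obtain ⟨K, _, _, φ, hφ, hφπ⟩ := exists_injective_arc_of_etale (k := k) (n := n) π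
  let χ : A →ₐ[k] PowerSeries K := φ.comp (IsScalarTower.toAlgHom k A S)
  have hχ : Function.Injective χ := hφ.comp hAS
  have hχp (z : A) : PowerSeries.constantCoeff (χ z) = 0 ↔ z ∈ p := (hφπ _).trans (hπ z)
  obtain ⟨s, hs⟩ : χ a ∣ χ d := by
    rw [hd, map_mul]
    exact (H K χ hχ).mul_left _
  have hstable (y : A) (hy : y ∈ p) : ∃ z ∈ p, y * d = a * z := by
    obtain ⟨z, hz⟩ := (hpy y).mp hy
    refine ⟨z, (hχp z).mp ?_, hz⟩
    have : χ z = χ y * s := by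
      refine mul_left_cancel₀ ((map_ne_zero_iff χ hχ).mpr ha) ?_
      rw [← map_mul, ← hz, map_mul, hs]
      ring
    rw [this, map_mul, (hχp y).mpr hy, zero_mul]
  let F := FractionRing S
  have hAF : Function.Injective (algebraMap A F) := by
    rw [IsScalarTower.algebraMap_eq A S F]
    exact (IsFractionRing.injective S F).comp hAS
  have haF : algebraMap A F a ≠ 0 := (map_ne_zero_iff _ hAF).mpr ha
  let u : F := algebraMap A F d / algebraMap A F a
  have hu : IsIntegral A u := by
    have : Module.IsTorsionFree A F :=
      (Module.isTorsionFree_iff_algebraMap_injective).mpr hAF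
    refine isIntegral_of_smul_mem_submodule (Submodule.map (Algebra.linearMap A F) p) ?_
      ((IsNoetherian.noetherian p).map _) u ?_
    · refine (Submodule.ne_bot_iff _).mpr ⟨_, ⟨a, ?_, rfl⟩, haF⟩
      exact (hpy a).mpr (dvd_mul_right _ _)
    · rintro _ ⟨y, hy, rfl⟩
      obtain ⟨z, hz, h⟩ := hstable y hy
      refine ⟨z, hz, ?_⟩
      change algebraMap A F z = algebraMap A F d / algebraMap A F a * algebraMap A F y
      rw [div_mul_eq_mul_div, eq_div_iff haF, ← map_mul, ← map_mul, mul_comm z, ← h, mul_comm]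
  obtain ⟨v, hv⟩ := IsIntegrallyClosed.isIntegral_iff.mp (hu.tower_top (A := S))
  obtain ⟨m, b, hb⟩ := IsLocalization.Away.surj f v
  apply hf
  refine hpp.mem_of_pow_mem m ((hpy _).mpr ⟨b, hAF ?_⟩)
  have hb' := congr_arg (algebraMap S F) hb
  rw [map_mul, hv, ← map_pow, ← IsScalarTower.algebraMap_apply, ← IsScalarTower.algebraMap_apply] at hb'
  rw [map_mul _ (f ^ m) d, map_mul _ a b, ← hb']
  rw [← mul_assoc, mul_div_cancel₀ _ haF, mul_comm]

theorem PowerSeries.dvd_of_order_le {K : Type*} [Field K] {f g : PowerSeries K}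
    (h : f.order ≤ g.order) : f ∣ g := by
  by_cases hf : f = 0
  · simp_all
  obtain ⟨u, hu⟩ := isUnit_divided_by_X_pow_order hf
  have hfu : PowerSeries.X ^ f.order.toNat * (u : PowerSeries K) = f := by
    rw [hu, X_pow_order_mul_divXPowOrder]
  rw [← hfu, Units.mul_right_dvd]
  refine PowerSeries.X_pow_dvd_iff.mpr fun m hm ↦ coeff_of_lt_order m (lt_of_lt_of_le ?_ h)
  rw [← coe_toNat_order hf]
  exact_mod_cast hm

theorem arcOrd_mul {A K : Type} [CommRing A] [Field K] (φ : A →+* PowerSeries K)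
    (I J : Ideal A) : arcOrd φ (I * J) = arcOrd φ I + arcOrd φ J := by
  have hmin (I : Ideal A) : ∃ a ∈ I, (φ a).order = arcOrd φ I := by
    obtain ⟨a, ha⟩ := ENat.exists_eq_iInf fun a : I ↦ (φ a).order
    exact ⟨a, a.2, ha.trans (iInf_subtype (p := (· ∈ I)) (f := fun a ↦ (φ a).order))⟩
  have hle {I : Ideal A} {a : A} (ha : a ∈ I) : arcOrd φ I ≤ (φ a).order := iInf₂_le a ha
  refine le_antisymm ?_ (le_iInf₂ fun x hx ↦ ?_)
  · obtain ⟨a, ha, hia⟩ := hmin I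
    obtain ⟨b, hb, hjb⟩ := hmin J
    rw [← hia, ← hjb, ← PowerSeries.order_mul, ← map_mul]
    exact hle (Ideal.mul_mem_mul ha hb)
  · induction hx using Submodule.mul_induction_on' with
    | mem_mul_mem a ha b hb =>
      rw [map_mul, PowerSeries.order_mul]
      exact add_le_add (hle ha) (hle hb)
    | add x _ y _ hx hy =>
      rw [map_add]
      exact (le_min hx hy).trans (PowerSeries.min_order_le_order_add _ _)

theorem le_of_forall_injective_arcOrd_eq {k A : Type} [Field k] [CommRing A] [IsDomain A]
    [Algebra k A] [Algebra.Smooth k A] {P Q Q' : Ideal A} {a : A} (ha : a ≠ 0)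
    (hQ : Q * Q' = Ideal.span {a})
    (H : ∀ (K : Type) [Field K] [Algebra k K] (φ : A →ₐ[k] PowerSeries K),
      Function.Injective φ →
        arcOrd (φ : A →+* PowerSeries K) P = arcOrd (φ : A →+* PowerSeries K) Q) :
    P ≤ Q := by
  have hle : P * Q' ≤ Ideal.span {a} := by
    intro b hb
    refine Ideal.mem_span_singleton.mpr (dvd_of_forall_injective_arc (k := k) ha fun K _ _ φ hφ ↦
      PowerSeries.dvd_of_order_le ?_)
    have hb' : arcOrd (φ : A →+* PowerSeries K) (P * Q') ≤ (φ b).order := iInf₂_le b hb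
    rw [arcOrd_mul, H K φ hφ, ← arcOrd_mul, hQ] at hb'
    refine le_trans (le_iInf₂ fun x hx ↦ ?_) hb'
    obtain ⟨y, rfl⟩ := Ideal.mem_span_singleton.mp hx
    rw [map_mul, PowerSeries.order_mul]
    exact le_self_add
  intro x hx
  have hax : a * x ∈ Ideal.span {a} * Q := by
    have : Ideal.span {a} * P ≤ Ideal.span {a} * Q := by
      rw [← hQ, mul_assoc, mul_comm Q' P, mul_comm Q, hQ]
      exact Ideal.mul_mono_left hle
    exact this (Ideal.mul_mem_mul (Ideal.mem_span_singleton_self a) hx)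
  obtain ⟨q, hq, h⟩ := Ideal.mem_span_singleton_mul.mp hax
  rwa [← mul_left_cancel₀ ha h]

/-- affine form; order functions determine Cartier divisors.
Let `X = Spec A` be a smooth irreducible affine variety over an algebraically closed
field `k` of characteristic `0`.  Let `D₁ = I₁⁺ − I₁⁻` and `D₂ = I₂⁺ − I₂⁻` be Cartier
divisors on `X` (each ideal invertible, i.e. with principal nonzero product with some
other ideal), and let `Z ⊊ X` be a proper closed subset, cut out by `J ≠ 0`, containing
the supports of `D₁` and `D₂` (i.e. `J ≤ √I` for each of the four ideals).  If
`ord_{D₁}(φ) = ord_{D₂}(φ)` for every arc `φ : Spec K[[t]] → X` (over any field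
extension `K` of `k`) whose generic point lands in `X ∖ Z`, then `D₁ = D₂`
(i.e. `I₁⁺·I₂⁻ = I₂⁺·I₁⁻`). -/
theorem statement19 (k : Type) [Field k] [IsAlgClosed k] [CharZero k]
    (A : Type) [CommRing A] [IsDomain A] [Algebra k A] [Algebra.Smooth k A]
    (I₁p I₁m I₂p I₂m : Ideal A)
    (hinv : ∀ I ∈ [I₁p, I₁m, I₂p, I₂m],
      ∃ (I' : Ideal A) (a : A), a ≠ 0 ∧ I * I' = Ideal.span {a})
    (J : Ideal A) (hJ : J ≠ ⊥)
    (hsupp : ∀ I ∈ [I₁p, I₁m, I₂p, I₂m], J ≤ I.radical)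
    (hord : ∀ (K : Type) [Field K] [Algebra k K] (φ : A →ₐ[k] PowerSeries K),
      (∃ a ∈ J, φ a ≠ 0) →
      arcOrd (φ : A →+* PowerSeries K) I₁p + arcOrd (φ : A →+* PowerSeries K) I₂m =
        arcOrd (φ : A →+* PowerSeries K) I₂p + arcOrd (φ : A →+* PowerSeries K) I₁m) :
    I₁p * I₂m = I₂p * I₁m := by
  have hprod {I₁ I₂ : Ideal A} (h₁ : ∃ (I' : Ideal A) (a : A), a ≠ 0 ∧ I₁ * I' = Ideal.span {a})
      (h₂ : ∃ (I' : Ideal A) (a : A), a ≠ 0 ∧ I₂ * I' = Ideal.span {a}) :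
      ∃ (I' : Ideal A) (a : A), a ≠ 0 ∧ I₁ * I₂ * I' = Ideal.span {a} := by
    obtain ⟨J₁, a₁, ha₁, e₁⟩ := h₁
    obtain ⟨J₂, a₂, ha₂, e₂⟩ := h₂
    exact ⟨J₁ * J₂, a₁ * a₂, mul_ne_zero ha₁ ha₂, by
      rw [mul_mul_mul_comm, e₁, e₂, Ideal.span_singleton_mul_span_singleton]⟩
  obtain ⟨j, hj, hj0⟩ := Submodule.exists_mem_ne_zero_of_ne_bot hJ
  have hPQ (K : Type) [Field K] [Algebra k K] (φ : A →ₐ[k] PowerSeries K)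
      (hφ : Function.Injective φ) : arcOrd (φ : A →+* PowerSeries K) (I₁p * I₂m) =
        arcOrd (φ : A →+* PowerSeries K) (I₂p * I₁m) := by
    rw [arcOrd_mul, arcOrd_mul]
    exact hord K φ ⟨j, hj, (map_ne_zero_iff φ hφ).mpr hj0⟩
  obtain ⟨P', a, ha, hP⟩ := hprod (hinv I₁p (by simp)) (hinv I₂m (by simp))
  obtain ⟨Q', b, hb, hQ⟩ := hprod (hinv I₂p (by simp)) (hinv I₁m (by simp))
  exact le_antisymm (le_of_forall_injective_arcOrd_eq hb hQ hPQ)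
    (le_of_forall_injective_arcOrd_eq ha hP fun K _ _ φ hφ ↦ (hPQ K φ hφ).symm)
end
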